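/- arXiv:2202.04594 — 3 statements merged into one kernel-verified Lean document; each statement's English description precedes it below -/
import Mathlib

section
/- Let n ≥ 1, let P and Q₀ be n×n real symmetric matrices with P and Q₀ positive definite, let Q₁ be an n×n real symmetric matrix, and let a ∈ ℝ, δ ≥ 0, ε > 0. Denote by λ_min(·) and λ_max(·) the minimal and maximal eigenvalues and by ‖·‖ the operator norm. Then for every x ∈ ℝⁿ with ‖x‖ ≥ ε: −λ_min(Q₀)‖x‖² + |a|·‖Q₁‖·‖x‖² + 2‖P‖·‖x‖·δ ≤ −( λ_min(Q₀)/λ_max(P) − |a|·‖Q₁‖/λ_min(P) − 2‖P‖δ/(ε·λ_min(P)) ) · (xᵀPx). -/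
open Matrix

/-- The minimal eigenvalue of a Hermitian real matrix. -/
noncomputable def lamMin {n : Type*} [Fintype n] [DecidableEq n] {M : Matrix n n ℝ}
    (hM : M.IsHermitian) : ℝ := ⨅ i, hM.eigenvalues i

/-- The maximal eigenvalue of a Hermitian real matrix. -/
noncomputable def lamMax {n : Type*} [Fintype n] [DecidableEq n] {M : Matrix n n ℝ}
    (hM : M.IsHermitian) : ℝ := ⨆ i, hM.eigenvalues i

/-- The (Euclidean ℓ²) operator norm of a real square matrix. -/
noncomputable def opNorm {n : Type*} [Fintype n] [DecidableEq n] (M : Matrix n n ℝ) : ℝ :=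
  ‖Matrix.toEuclideanCLM (𝕜 := ℝ) M‖

/-- The Euclidean norm of a vector in `ℝⁿ`. -/
noncomputable def euclNorm {n : Type*} [Fintype n] (x : n → ℝ) : ℝ :=
  Real.sqrt (x ⬝ᵥ x)

theorem rayleigh_aux {n : ℕ} {M : Matrix (Fin n) (Fin n) ℝ} (hM : M.IsHermitian)
    (x : Fin n → ℝ) : ∃ c : Fin n → ℝ, x ⬝ᵥ x = ∑ i, c i ^ 2 ∧
      x ⬝ᵥ M.mulVec x = ∑ i, hM.eigenvalues i * c i ^ 2 := by
  have key : ∀ y : Fin n → ℝ, x ⬝ᵥ y =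
      ∑ i, ((hM.eigenvectorBasis i).ofLp ⬝ᵥ x) * ((hM.eigenvectorBasis i).ofLp ⬝ᵥ y) := by
    intro y
    have h := hM.eigenvectorBasis.sum_inner_mul_inner (WithLp.toLp 2 x) (WithLp.toLp 2 y)
    simp only [EuclideanSpace.inner_eq_star_dotProduct, star_trivial] at h
    rw [dotProduct_comm x y, ← h]
    refine Finset.sum_congr rfl fun i _ => ?_
    rw [dotProduct_comm y]
  refine ⟨fun i => (hM.eigenvectorBasis i).ofLp ⬝ᵥ x, ?_, ?_⟩
  · rw [key x]
    exact Finset.sum_congr rfl fun i _ => by ring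
  · rw [key]
    refine Finset.sum_congr rfl fun i _ => ?_
    have hT : Mᵀ = M := by simpa [IsHermitian, conjTranspose_eq_transpose_of_trivial] using hM
    have : (hM.eigenvectorBasis i).ofLp ⬝ᵥ M.mulVec x
        = hM.eigenvalues i * ((hM.eigenvectorBasis i).ofLp ⬝ᵥ x) := by
      rw [dotProduct_mulVec, ← mulVec_transpose, hT, hM.mulVec_eigenvectorBasis]
      simp
    rw [this]; ring

theorem lamMin_le_rayleigh {n : ℕ} {M : Matrix (Fin n) (Fin n) ℝ} (hM : M.IsHermitian)
    (x : Fin n → ℝ) : lamMin hM * (x ⬝ᵥ x) ≤ x ⬝ᵥ M.mulVec x := by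
  obtain ⟨c, h1, h2⟩ := rayleigh_aux hM x
  rw [h1, h2, Finset.mul_sum]
  exact Finset.sum_le_sum fun i _ => mul_le_mul_of_nonneg_right
    (ciInf_le (Set.finite_range _).bddBelow i) (sq_nonneg _)

theorem rayleigh_le_lamMax {n : ℕ} {M : Matrix (Fin n) (Fin n) ℝ} (hM : M.IsHermitian)
    (x : Fin n → ℝ) : x ⬝ᵥ M.mulVec x ≤ lamMax hM * (x ⬝ᵥ x) := by
  obtain ⟨c, h1, h2⟩ := rayleigh_aux hM x
  rw [h1, h2, Finset.mul_sum]
  exact Finset.sum_le_sum fun i _ => mul_le_mul_of_nonneg_right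
    (le_ciSup (Set.finite_range _).bddAbove i) (sq_nonneg _)

theorem lamMin_pos {n : ℕ} (hn : 1 ≤ n) {M : Matrix (Fin n) (Fin n) ℝ} (hM : M.PosDef) :
    0 < lamMin hM.1 := by
  haveI : Nonempty (Fin n) := ⟨⟨0, hn⟩⟩
  obtain ⟨i, hi⟩ := exists_eq_ciInf_of_finite (f := hM.1.eigenvalues)
  unfold lamMin
  rw [← hi]
  exact hM.eigenvalues_pos i

theorem lamMax_pos {n : ℕ} (hn : 1 ≤ n) {M : Matrix (Fin n) (Fin n) ℝ} (hM : M.PosDef) :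
    0 < lamMax hM.1 :=
  lt_of_lt_of_le (hM.eigenvalues_pos ⟨0, hn⟩) (le_ciSup (Set.finite_range _).bddAbove _)

/-- The central algebraic estimate converting the Lyapunov derivative
bound into `V̇ ≤ −γ V` outside the ball of radius `ε`. -/
theorem lyapunov_rate_estimate {n : ℕ} (hn : 1 ≤ n)
    (P Q0 Q1 : Matrix (Fin n) (Fin n) ℝ)
    (hP : P.PosDef) (hQ0 : Q0.PosDef) (hQ1 : Q1.IsSymm)
    (a δ ε : ℝ) (hδ : 0 ≤ δ) (hε : 0 < ε)
    (x : Fin n → ℝ) (hx : ε ≤ euclNorm x) :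
    -(lamMin hQ0.1) * euclNorm x ^ 2 + |a| * opNorm Q1 * euclNorm x ^ 2
        + 2 * opNorm P * euclNorm x * δ
      ≤ -(lamMin hQ0.1 / lamMax hP.1 - |a| * opNorm Q1 / lamMin hP.1
            - 2 * opNorm P * δ / (ε * lamMin hP.1)) * (x ⬝ᵥ P.mulVec x) := by
  have hxx : 0 ≤ x ⬝ᵥ x := by
    simpa using dotProduct_star_self_nonneg x
  have hsq : euclNorm x ^ 2 = x ⬝ᵥ x := Real.sq_sqrt hxx
  have hlo := lamMin_le_rayleigh hP.1 x
  have hhi := rayleigh_le_lamMax hP.1 x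
  have hm := lamMin_pos hn hP
  have hM := lamMax_pos hn hP
  have hq := lamMin_pos hn hQ0
  have hp1 : 0 ≤ opNorm Q1 := norm_nonneg _
  have hp : 0 ≤ opNorm P := norm_nonneg _
  rw [← hsq] at hlo hhi
  generalize x ⬝ᵥ P.mulVec x = V at *
  generalize euclNorm x = r at *
  generalize lamMin hP.1 = m at *
  generalize lamMax hP.1 = L at *
  generalize lamMin hQ0.1 = q at *
  have e1 : V / L ≤ r ^ 2 := by rw [div_le_iff₀ hM]; linarith
  have e2 : r ^ 2 ≤ V / m := by rw [le_div_iff₀ hm]; linarith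
  have e3 : r ≤ V / m / ε := by
    rw [le_div_iff₀ hε]
    nlinarith
  have f1 := mul_le_mul_of_nonneg_left e1 hq.le
  have f2 := mul_le_mul_of_nonneg_left e2 (mul_nonneg (abs_nonneg a) hp1)
  have f3 := mul_le_mul_of_nonneg_left e3 (mul_nonneg (mul_nonneg zero_le_two hp) hδ)
  have e : -(q / L - |a| * opNorm Q1 / m - 2 * opNorm P * δ / (ε * m)) * V
      = -(q * (V / L)) + |a| * opNorm Q1 * (V / m) + 2 * opNorm P * δ * (V / m / ε) := by
    field_simp
    ring
  rw [e]
  linarith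
end

section
/- Let R, L, l_p, l_i, m, δ, ε > 0. Define A₀ = [[−R/L, −1/L],[l_i, 0]], A₁ = [[0, 0],[−R/L, −1/L]], and μ(x) = l_p·x/((x/m)² + 1). Let P be a 2×2 real symmetric positive definite matrix such that Q₀ := −(A₀ᵀP + PA₀) is positive definite, set Q₁ := A₁ᵀP + PA₁, and suppose γ* := λ_min(Q₀)/λ_max(P) − l_p·‖Q₁‖/λ_min(P) − 2‖P‖δ/(ε·λ_min(P)) > 0. Let T₀ ∈ ℝ and let d : [T₀, ∞) → ℝ² be differentiable with |d₁(t)| ≤ m for all t, and suppose d'(t) = A₀ d(t) + μ'(d₁(t))·(A₁ d(t)) + w(t)·(0,1) where |w(t)| ≤ δ for all t. Then for every t ≥ T₀ at which ‖d(t)‖ ≥ ε, the function V(t) = d(t)ᵀ P d(t) satisfies V'(t) ≤ −γ* · V(t); in particular, there exists a finite time T_f ≥ T₀ with ‖d(T_f)‖ ≤ ε. -/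
open Matrix

lemma aux_inner {n : Type*} [Fintype n] (x y : n → ℝ) :
    inner ℝ (WithLp.toLp 2 x) (WithLp.toLp 2 y) = x ⬝ᵥ y := by
  simp [PiLp.inner_apply, dotProduct, mul_comm]

lemma aux_norm {n : Type*} [Fintype n] (x : n → ℝ) :
    ‖(WithLp.toLp 2 x : EuclideanSpace ℝ n)‖ = euclNorm x := by
  rw [euclNorm, ← aux_inner, real_inner_self_eq_norm_sq, Real.sqrt_sq (norm_nonneg _)]

lemma aux_op {n : Type*} [Fintype n] [DecidableEq n] (M : Matrix n n ℝ) (x y : n → ℝ) :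
    |x ⬝ᵥ M *ᵥ y| ≤ opNorm M * euclNorm x * euclNorm y := by
  rw [← aux_inner, ← aux_norm, ← aux_norm]
  have h := abs_real_inner_le_norm (WithLp.toLp 2 x : EuclideanSpace ℝ n) (WithLp.toLp 2 (M *ᵥ y))
  have h2 := (Matrix.toEuclideanCLM (𝕜 := ℝ) M).le_opNorm (WithLp.toLp 2 y)
  rw [Matrix.toEuclideanCLM_toLp] at h2
  unfold opNorm
  nlinarith [norm_nonneg (WithLp.toLp 2 x : EuclideanSpace ℝ n)]

lemma aux_sq {n : Type*} [Fintype n] (x : n → ℝ) : euclNorm x ^ 2 = x ⬝ᵥ x := by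
  rw [← aux_norm, ← real_inner_self_eq_norm_sq, aux_inner]

lemma aux_spec {n : Type*} [Fintype n] [DecidableEq n] {M : Matrix n n ℝ}
    (hM : M.IsHermitian) (x : n → ℝ) :
    x ⬝ᵥ M *ᵥ x = ∑ i, hM.eigenvalues i * ((hM.eigenvectorBasis i).ofLp ⬝ᵥ x) ^ 2 := by
  rw [← aux_inner, ← hM.eigenvectorBasis.sum_inner_mul_inner]
  refine Finset.sum_congr rfl fun i _ => ?_
  have h1 : inner ℝ (WithLp.toLp 2 x) (hM.eigenvectorBasis i)
      = (hM.eigenvectorBasis i).ofLp ⬝ᵥ x := by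
    rw [real_inner_comm, ← aux_inner]
  have h2 : inner ℝ (hM.eigenvectorBasis i) (WithLp.toLp 2 (M *ᵥ x))
      = hM.eigenvalues i * ((hM.eigenvectorBasis i).ofLp ⬝ᵥ x) := by
    have : inner ℝ (hM.eigenvectorBasis i) (WithLp.toLp 2 (M *ᵥ x))
      = (hM.eigenvectorBasis i).ofLp ⬝ᵥ (M *ᵥ x) := by rw [← aux_inner]
    rw [this, dotProduct_mulVec, ← mulVec_transpose]
    have ht : Mᵀ = M := by simpa using hM.eq
    rw [ht, hM.mulVec_eigenvectorBasis, smul_dotProduct, smul_eq_mul]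
  rw [h1, h2]; ring

lemma aux_pars {n : Type*} [Fintype n] [DecidableEq n] {M : Matrix n n ℝ}
    (hM : M.IsHermitian) (x : n → ℝ) :
    x ⬝ᵥ x = ∑ i, ((hM.eigenvectorBasis i).ofLp ⬝ᵥ x) ^ 2 := by
  rw [← aux_inner, ← hM.eigenvectorBasis.sum_inner_mul_inner]
  refine Finset.sum_congr rfl fun i _ => ?_
  have h1 : inner ℝ (hM.eigenvectorBasis i) (WithLp.toLp 2 x)
      = (hM.eigenvectorBasis i).ofLp ⬝ᵥ x := by
    rw [← aux_inner]
  rw [real_inner_comm, h1]; ring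

lemma aux_min {n : Type*} [Fintype n] [DecidableEq n] {M : Matrix n n ℝ}
    (hM : M.IsHermitian) (x : n → ℝ) :
    lamMin hM * (x ⬝ᵥ x) ≤ x ⬝ᵥ M *ᵥ x := by
  rw [aux_spec hM, aux_pars hM, Finset.mul_sum]
  refine Finset.sum_le_sum fun i _ => mul_le_mul_of_nonneg_right ?_ (sq_nonneg _)
  exact ciInf_le (Set.finite_range _).bddBelow i

lemma aux_max {n : Type*} [Fintype n] [DecidableEq n] {M : Matrix n n ℝ}
    (hM : M.IsHermitian) (x : n → ℝ) :
    x ⬝ᵥ M *ᵥ x ≤ lamMax hM * (x ⬝ᵥ x) := by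
  rw [aux_spec hM, aux_pars hM, Finset.mul_sum]
  refine Finset.sum_le_sum fun i _ => mul_le_mul_of_nonneg_right ?_ (sq_nonneg _)
  exact le_ciSup (Set.finite_range hM.eigenvalues).bddAbove i

lemma aux_min_pos {n : Type*} [Fintype n] [Nonempty n] [DecidableEq n] {M : Matrix n n ℝ}
    (hM : M.PosDef) : 0 < lamMin hM.1 := by
  obtain ⟨i, hi⟩ := exists_eq_ciInf_of_finite (f := hM.1.eigenvalues)
  unfold lamMin
  rw [← hi]
  exact hM.eigenvalues_pos i

lemma aux_max_pos {n : Type*} [Fintype n] [Nonempty n] [DecidableEq n] {M : Matrix n n ℝ}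
    (hM : M.PosDef) : 0 < lamMax hM.1 := by
  obtain ⟨i⟩ := ‹Nonempty n›
  exact (hM.eigenvalues_pos i).trans_le (le_ciSup (Set.finite_range hM.1.eigenvalues).bddAbove i)

lemma aux_mu (lp m : ℝ) (hlp : 0 < lp) (hm : 0 < m)
    (μ : ℝ → ℝ) (hμ : ∀ x : ℝ, μ x = lp * x / ((x / m) ^ 2 + 1)) (x : ℝ) :
    |deriv μ x| ≤ lp := by
  have hpos : 0 < (x / m) ^ 2 + 1 := by positivity
  have h : HasDerivAt μ (lp * (1 - (x / m) ^ 2) / ((x / m) ^ 2 + 1) ^ 2) x := by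
    have e : μ = fun x => lp * x / ((x / m) ^ 2 + 1) := funext hμ
    rw [e]
    have h1 : HasDerivAt (fun x : ℝ => lp * x) (lp * 1) x := (hasDerivAt_id x).const_mul lp
    have h2 : HasDerivAt (fun x : ℝ => (x / m) ^ 2 + 1) (2 * (x / m) ^ 1 * (1 / m)) x := by
      simpa using (((hasDerivAt_id x).div_const m).pow 2).add_const 1
    refine (h1.div h2 hpos.ne').congr_deriv ?_
    field_simp
    ring
  rw [h.deriv, abs_div, abs_of_pos (pow_pos hpos 2), div_le_iff₀ (pow_pos hpos 2), abs_mul,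
    abs_of_pos hlp]
  refine mul_le_mul_of_nonneg_left ?_ hlp.le
  rw [abs_le]
  constructor <;> nlinarith [sq_nonneg (x / m), sq_nonneg ((x / m) ^ 2)]

/-- **Theorem 1 of the paper.** Exponential decay of the Lyapunov function
of the inner-loop N-PI-DOB estimation error outside the ball of radius `ε`, and
convergence of the estimation error into that ball in finite time. -/
theorem inner_loop_dob_convergence (R L lp li m δ ε : ℝ)
    (hR : 0 < R) (hL : 0 < L) (hlp : 0 < lp) (hli : 0 < li) (hm : 0 < m)
    (hδ : 0 < δ) (hε : 0 < ε)
    (A0 A1 : Matrix (Fin 2) (Fin 2) ℝ)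
    (hA0 : A0 = !![-R / L, -1 / L; li, 0])
    (hA1 : A1 = !![0, 0; -R / L, -1 / L])
    (μ : ℝ → ℝ) (hμ : ∀ x : ℝ, μ x = lp * x / ((x / m) ^ 2 + 1))
    (P : Matrix (Fin 2) (Fin 2) ℝ) (hP : P.PosDef)
    (hQ0 : (-(A0ᵀ * P + P * A0)).PosDef)
    (γstar : ℝ)
    (hγdef : γstar = lamMin hQ0.1 / lamMax hP.1
        - lp * opNorm (A1ᵀ * P + P * A1) / lamMin hP.1
        - 2 * opNorm P * δ / (ε * lamMin hP.1))
    (hγpos : 0 < γstar)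
    (T0 : ℝ) (d : ℝ → Fin 2 → ℝ) (w : ℝ → ℝ)
    (hd1 : ∀ t, T0 ≤ t → |d t 0| ≤ m)
    (hw : ∀ t, T0 ≤ t → |w t| ≤ δ)
    (hode : ∀ t, T0 ≤ t →
      HasDerivAt d (A0.mulVec (d t) + deriv μ (d t 0) • A1.mulVec (d t) + w t • ![0, 1]) t) :
    (∀ t, T0 ≤ t → ε ≤ euclNorm (d t) →
        deriv (fun s => d s ⬝ᵥ P.mulVec (d s)) t ≤ -γstar * (d t ⬝ᵥ P.mulVec (d t))) ∧
      ∃ Tf : ℝ, T0 ≤ Tf ∧ euclNorm (d Tf) ≤ ε := by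
  have hlmP := aux_min_pos hP
  have hlMP := aux_max_pos hP
  have hlmQ := aux_min_pos hQ0
  have hsym : P 1 0 = P 0 1 := by simpa using hP.1.apply 0 1
  have hV : ∀ t, T0 ≤ t → HasDerivAt (fun s => d s ⬝ᵥ P.mulVec (d s))
      (-(d t ⬝ᵥ (-(A0ᵀ * P + P * A0)) *ᵥ d t)
        + deriv μ (d t 0) * (d t ⬝ᵥ (A1ᵀ * P + P * A1) *ᵥ d t)
        + 2 * w t * (![0, 1] ⬝ᵥ P *ᵥ d t)) t := by
    intro t ht
    have h := hasDerivAt_pi.1 (hode t ht)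
    have h0 := h 0
    have h1 := h 1
    have e : (fun s => d s ⬝ᵥ P.mulVec (d s)) = fun s =>
        d s 0 * (P 0 0 * d s 0 + P 0 1 * d s 1) + d s 1 * (P 0 1 * d s 0 + P 1 1 * d s 1) := by
      funext s
      simp [dotProduct, mulVec, Fin.sum_univ_two, hsym]
    rw [e]
    refine HasDerivAt.congr_deriv ((h0.mul ((h0.const_mul (P 0 0)).add (h1.const_mul (P 0 1)))).add
      (h1.mul ((h0.const_mul (P 0 1)).add (h1.const_mul (P 1 1))))) ?_
    generalize deriv μ (d t 0) = q
    simp [dotProduct, mulVec, Fin.sum_univ_two, hsym, Matrix.mul_apply]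
    ring
  have key : ∀ t, T0 ≤ t → ε ≤ euclNorm (d t) →
      deriv (fun s => d s ⬝ᵥ P.mulVec (d s)) t ≤ -γstar * (d t ⬝ᵥ P.mulVec (d t)) := by
    intro t ht hεt
    rw [(hV t ht).deriv]
    have hq := aux_mu lp m hlp hm μ hμ (d t 0)
    have b0 := aux_min hQ0.1 (d t)
    have b1 := aux_op (A1ᵀ * P + P * A1) (d t) (d t)
    have b2 := aux_op P ![0, 1] (d t)
    have he : euclNorm (![0, 1] : Fin 2 → ℝ) = 1 := by simp [euclNorm]
    have c0 := aux_min hP.1 (d t)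
    have c1 := aux_max hP.1 (d t)
    have hs := aux_sq (d t)
    have hwt := hw t ht
    have hN1 : 0 ≤ opNorm (A1ᵀ * P + P * A1) := norm_nonneg _
    have hN2 : 0 ≤ opNorm P := norm_nonneg _
    rw [he, mul_one] at b2
    rw [mul_assoc, ← sq] at b1
    rw [← hs] at b0 c0 c1
    generalize d t ⬝ᵥ (-(A0ᵀ * P + P * A0)) *ᵥ d t = X0 at *
    generalize d t ⬝ᵥ (A1ᵀ * P + P * A1) *ᵥ d t = X1 at *
    generalize (![0, 1] : Fin 2 → ℝ) ⬝ᵥ P *ᵥ d t = X2 at *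
    generalize d t ⬝ᵥ P *ᵥ d t = V at *
    generalize opNorm (A1ᵀ * P + P * A1) = N1 at *
    generalize opNorm P = N2 at *
    generalize euclNorm (d t) = r at *
    generalize lamMin hP.1 = a at *
    generalize lamMax hP.1 = b at *
    generalize lamMin hQ0.1 = c at *
    generalize deriv μ (d t 0) = q at *
    have f1 : q * X1 ≤ lp * (N1 * r ^ 2) := by
      refine (le_abs_self _).trans ?_
      rw [abs_mul]
      exact mul_le_mul hq b1 (abs_nonneg _) hlp.le
    have f2 : w t * X2 ≤ δ * (N2 * r) := by
      refine (le_abs_self _).trans ?_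
      rw [abs_mul]
      exact mul_le_mul hwt b2 (abs_nonneg _) hδ.le
    have g0 : c / b * V ≤ c * r ^ 2 := by
      rw [div_mul_eq_mul_div, div_le_iff₀ hlMP]
      nlinarith
    have hrV : r ^ 2 ≤ V / a := by rw [le_div_iff₀ hlmP]; linarith
    have g1 : lp * (N1 * r ^ 2) ≤ lp * N1 / a * V := by
      calc lp * (N1 * r ^ 2) = (lp * N1) * r ^ 2 := by ring
        _ ≤ (lp * N1) * (V / a) := by gcongr
        _ = _ := by ring
    have hr : r ≤ V / a / ε := by
      rw [le_div_iff₀ hε]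
      nlinarith
    have g2 : 2 * (δ * (N2 * r)) ≤ 2 * N2 * δ / (ε * a) * V := by
      calc 2 * (δ * (N2 * r)) = (2 * N2 * δ) * r := by ring
        _ ≤ (2 * N2 * δ) * (V / a / ε) := by gcongr
        _ = _ := by field_simp
    rw [hγdef]
    nlinarith
  refine ⟨key, ?_⟩
  by_contra! hcon
  set c := γstar * (lamMin hP.1 * ε ^ 2) with hc
  have hcpos : 0 < c := by positivity
  have hd : ∀ t, T0 ≤ t → HasDerivAt (fun s => d s ⬝ᵥ P.mulVec (d s) + c * s)
      (deriv (fun s => d s ⬝ᵥ P.mulVec (d s)) t + c * 1) t := fun t ht =>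
    (hV t ht).differentiableAt.hasDerivAt.add ((hasDerivAt_id t).const_mul c)
  have hlow : ∀ t, T0 ≤ t → lamMin hP.1 * ε ^ 2 ≤ d t ⬝ᵥ P *ᵥ d t := by
    intro t ht
    refine le_trans ?_ (aux_min hP.1 (d t))
    rw [← aux_sq]
    have := (hcon t ht).le
    gcongr
  have hanti : AntitoneOn (fun s => d s ⬝ᵥ P.mulVec (d s) + c * s) (Set.Ici T0) := by
    refine antitoneOn_of_deriv_nonpos (convex_Ici _)
      (fun t ht => (hd t ht).continuousAt.continuousWithinAt)
      (fun t ht => (hd t (interior_subset ht)).differentiableAt.differentiableWithinAt) ?_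
    intro t ht
    have ht : T0 ≤ t := interior_subset ht
    rw [(hd t ht).deriv]
    have h1 := key t ht (hcon t ht).le
    have h2 := mul_le_mul_of_nonneg_left (hlow t ht) hγpos.le
    linarith
  have hV0 := hlow T0 le_rfl
  have hV0pos : 0 < d T0 ⬝ᵥ P *ᵥ d T0 := lt_of_lt_of_le (by positivity) hV0
  have hT : T0 ≤ T0 + (d T0 ⬝ᵥ P *ᵥ d T0) / c := by
    have := div_pos hV0pos hcpos
    linarith
  have h3 := hanti (Set.mem_Ici.2 le_rfl) (Set.mem_Ici.2 hT) hT
  have h4 := hlow _ hT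
  have h5 : 0 < lamMin hP.1 * ε ^ 2 := by positivity
  simp only [mul_add, mul_div_cancel₀ _ hcpos.ne'] at h3
  have h6 : c * ((d T0 ⬝ᵥ P *ᵥ d T0) / c) = d T0 ⬝ᵥ P *ᵥ d T0 := by field_simp
  linarith
end

section
/- Let R, L, η₁, η₂ > 0, and let e : ℝ → ℝ², d : ℝ → ℝ², d̂ : ℝ → ℝ² be functions with e differentiable and, for all t, e'(t) = −(R/L)·e(t) + (1/L)·(u(t) − d(t)), where u(t) ∈ ℝ² is defined componentwise by u_i(t) = −η₁·e_i(t)/(V(t) + η₂) + d̂_i(t) with V(t) = ‖e(t)‖². Then V is differentiable and, for all t, V'(t) ≤ −(2η₁/L)·V(t)/(V(t) + η₂) + (2/L)·|e₁(t)·d̃₁(t) + e₂(t)·d̃₂(t)|, where d̃(t) = d(t) − d̂(t). -/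
open Matrix

/-- **Lyapunov derivative estimate of Theorem 2.** For the current
tracking error dynamics `e' = −(R/L)e + (1/L)(u − d)` in the αβ frame with the
Lyapunov-based nonlinear control law `uᵢ = −η₁eᵢ/(V + η₂) + d̂ᵢ`, where `V = ‖e‖²`,
the function `V` is differentiable and satisfies
`V' ≤ −(2η₁/L)·V/(V + η₂) + (2/L)|e₁d̃₁ + e₂d̃₂|` with `d̃ = d − d̂`. -/
theorem currents_lyapunov_estimate (R L η1 η2 : ℝ)
    (hR : 0 < R) (hL : 0 < L) (hη1 : 0 < η1) (hη2 : 0 < η2)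
    (e d dhat u : ℝ → Fin 2 → ℝ) (V : ℝ → ℝ)
    (hV : ∀ t, V t = e t ⬝ᵥ e t)
    (hu : ∀ t, ∀ i : Fin 2, u t i = -η1 * e t i / (V t + η2) + dhat t i)
    (he : ∀ t : ℝ, HasDerivAt e (-(R / L) • e t + (1 / L) • (u t - d t)) t) :
    ∀ t : ℝ, DifferentiableAt ℝ V t ∧
      deriv V t ≤ -(2 * η1 / L) * (V t / (V t + η2))
        + (2 / L) * |e t 0 * (d t 0 - dhat t 0) + e t 1 * (d t 1 - dhat t 1)| := by
  intro t
  have h0 := (hasDerivAt_pi.1 (he t)) 0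
  have h1 := (hasDerivAt_pi.1 (he t)) 1
  have hVf : V = fun s => e s 0 * e s 0 + e s 1 * e s 1 := by
    funext s
    simp [hV, dotProduct, Fin.sum_univ_two]
  have hVt : V t = e t 0 * e t 0 + e t 1 * e t 1 := congrFun hVf t
  have hD := (h0.mul h0).add (h1.mul h1)
  have hD' := hD.congr_of_eventuallyEq (f₁ := V) (Filter.Eventually.of_forall (congrFun hVf))
  refine ⟨hD'.differentiableAt, ?_⟩
  rw [hD'.deriv]
  simp only [Pi.add_apply, Pi.smul_apply, Pi.sub_apply, smul_eq_mul, hu]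
  set x := e t 0
  set y := e t 1
  set a := d t 0 - dhat t 0 with ha
  set b := d t 1 - dhat t 1 with hb
  have hd0 : d t 0 = a + dhat t 0 := by rw [ha]; ring
  have hd1 : d t 1 = b + dhat t 1 := by rw [hb]; ring
  rw [hd0, hd1]
  have hVnn : 0 ≤ V t := by rw [hVt]; exact add_nonneg (mul_self_nonneg _) (mul_self_nonneg _)
  have key : -(2 * R / L) * V t - (2 / L) * (x * a + y * b)
      ≤ (2 / L) * |x * a + y * b| := by
    have e1 : 0 ≤ (2 * R / L) * V t := by positivity
    have e2 : (2 / L) * (-(x * a + y * b)) ≤ (2 / L) * |x * a + y * b| :=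
      mul_le_mul_of_nonneg_left (neg_le_abs _) (by positivity)
    linarith
  have e3 : -(2 * η1 / L) * (V t / (V t + η2))
      = -(2 * η1 / L) * ((x * x + y * y) / (V t + η2)) := by
    rw [← hVt]
  have e4 : -(2 * R / L) * V t = -(2 * R / L) * (x * x + y * y) := by
    rw [← hVt]
  rw [e4] at key
  rw [e3]
  refine le_trans (le_of_eq ?_) (add_le_add_right key _)
  ring
end
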